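/- arXiv:2603.16510 — 10 statements merged into one kernel-verified Lean document; each statement's English description precedes it below -/
import Mathlib

section
/- Let (a₁,a₂) and (b₁,b₂) be feasible, commonly ordered two-robot configurations and let d be any real number with d ≥ max(‖a₁ − b₁‖₁, ‖a₂ − b₂‖₁). Then there exists a feasible schedule (m₁, m₂) over [0,d] from (a₁,a₂) to (b₁,b₂) in which each robot makes at most one turn: for each i ∈ {1,2}, the image of mᵢ on [0,d] is contained in the union of the horizontal segment joining aᵢ to the point (x(bᵢ), y(aᵢ)) and the vertical segment joining (x(bᵢ), y(aᵢ)) to bᵢ. -/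
/-- The L1 norm of a point of the plane. -/
noncomputable def l1 (p : ℝ × ℝ) : ℝ := |p.1| + |p.2|

/-- Two unit-square robots centered at `p₁`, `p₂` are interior disjoint. -/
def Feasible2 (p₁ p₂ : ℝ × ℝ) : Prop := max |p₁.1 - p₂.1| |p₁.2 - p₂.2| ≥ 1

/-- `m` is 1-Lipschitz on `[0, T]` with respect to the L1 distance. -/
def Lip1On (m : ℝ → ℝ × ℝ) (T : ℝ) : Prop :=
  ∀ s ∈ Set.Icc (0:ℝ) T, ∀ t ∈ Set.Icc (0:ℝ) T, l1 (m s - m t) ≤ |s - t|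

/-- `(m₁, m₂)` is a feasible schedule from `(a₁,a₂)` to `(b₁,b₂)` over `[0,T]`. -/
def IsSchedule2 (m₁ m₂ : ℝ → ℝ × ℝ) (a₁ a₂ b₁ b₂ : ℝ × ℝ) (T : ℝ) : Prop :=
  0 ≤ T ∧ m₁ 0 = a₁ ∧ m₂ 0 = a₂ ∧ m₁ T = b₁ ∧ m₂ T = b₂ ∧
  Lip1On m₁ T ∧ Lip1On m₂ T ∧
  ∀ t ∈ Set.Icc (0:ℝ) T, Feasible2 (m₁ t) (m₂ t)

/-- The configurations `(a₁,a₂)` and `(b₁,b₂)` are commonly ordered. -/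
def CommonlyOrdered2 (a₁ a₂ b₁ b₂ : ℝ × ℝ) : Prop :=
  (a₁.1 ≥ a₂.1 + 1 ∧ b₁.1 ≥ b₂.1 + 1) ∨
  (a₂.1 ≥ a₁.1 + 1 ∧ b₂.1 ≥ b₁.1 + 1) ∨
  (a₁.2 ≥ a₂.2 + 1 ∧ b₁.2 ≥ b₂.2 + 1) ∨
  (a₂.2 ≥ a₁.2 + 1 ∧ b₂.2 ≥ b₁.2 + 1)

/-- The robot makes at most one turn: its trajectory on `[0,T]` stays in the union of the
horizontal segment from `a` to `(x(b), y(a))` and the vertical segment from there to `b`. -/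
def AtMostOneTurn (m : ℝ → ℝ × ℝ) (a b : ℝ × ℝ) (T : ℝ) : Prop :=
  ∀ t ∈ Set.Icc (0:ℝ) T, m t ∈ segment ℝ a (b.1, a.2) ∪ segment ℝ (b.1, a.2) b

/-- Position at time `t` of a point travelling on the line from `a` to `b` at unit speed. -/
noncomputable def eager (a b t : ℝ) : ℝ := max (a - t) (min (a + t) b)

lemma eager_zero (a b : ℝ) : eager a b 0 = a := by
  simp [eager]

lemma eager_done (a b t : ℝ) (h : |a - b| ≤ t) : eager a b t = b := by
  obtain ⟨h1, h2⟩ := abs_le.1 h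
  unfold eager
  rw [min_eq_right (by linarith), max_eq_right (by linarith)]

lemma eager_lip (a b s t : ℝ) : |eager a b s - eager a b t| ≤ |s - t| := by
  unfold eager
  refine (abs_max_sub_max_le_max _ _ _ _).trans (max_le ?_ ?_)
  · rw [show a - s - (a - t) = -(s - t) by ring, abs_neg]
  · refine (abs_min_sub_min_le_max _ _ _ _).trans (max_le ?_ ?_)
    · rw [show a + s - (a + t) = s - t by ring]
    · simp

lemma eager_mono (a b a' b' t : ℝ) (ha : a' + 1 ≤ a) (hb : b' + 1 ≤ b) :
    eager a' b' t + 1 ≤ eager a b t := by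
  unfold eager
  rw [← max_add_add_right, ← min_add_add_right]
  exact max_le_max (by linarith) (min_le_min (by linarith) hb)

lemma eager_mem (a b t : ℝ) (ht : 0 ≤ t) : eager a b t ∈ segment ℝ a b := by
  rw [segment_eq_uIcc, Set.mem_uIcc]
  unfold eager
  rcases le_total a b with h | h
  · left
    exact ⟨le_max_of_le_right (le_min (by linarith) h), max_le (by linarith) (min_le_right _ _)⟩
  · right
    exact ⟨le_max_of_le_right (le_min (by linarith) le_rfl),
      max_le (by linarith) ((min_le_right _ _).trans h)⟩

/-- Horizontal motion as early as possible, vertical motion as late as possible. -/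
noncomputable def sched (a b : ℝ × ℝ) (d t : ℝ) : ℝ × ℝ :=
  (eager a.1 b.1 t, eager b.2 a.2 (d - t))

lemma sched_bound (a b : ℝ × ℝ) (d : ℝ) (hd : l1 (a - b) ≤ d) : |a.1 - b.1| + |b.2 - a.2| ≤ d := by
  rw [abs_sub_comm b.2]; simpa [l1] using hd

lemma sched_zero (a b : ℝ × ℝ) (d : ℝ) (hd : l1 (a - b) ≤ d) : sched a b d 0 = a := by
  have := sched_bound a b d hd
  have h1 := abs_nonneg (a.1 - b.1)
  ext
  · exact eager_zero _ _
  · exact eager_done _ _ _ (by linarith)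

lemma sched_end (a b : ℝ × ℝ) (d : ℝ) (hd : l1 (a - b) ≤ d) : sched a b d d = b := by
  have := sched_bound a b d hd
  have h1 := abs_nonneg (b.2 - a.2)
  ext
  · exact eager_done _ _ _ (by linarith)
  · simp [sched, eager_zero]

lemma sched_lip_le (a b : ℝ × ℝ) (d : ℝ) (hd : l1 (a - b) ≤ d)
    (s t : ℝ) (hst : s ≤ t) : l1 (sched a b d s - sched a b d t) ≤ t - s := by
  have hb := sched_bound a b d hd
  have key : ∀ s t, s ≤ t → |eager a.1 b.1 s - eager a.1 b.1 t| ≤ t - s := fun s t h => by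
    simpa [abs_of_nonpos (sub_nonpos.2 h)] using eager_lip a.1 b.1 s t
  have key2 : ∀ s t, s ≤ t →
      |eager b.2 a.2 (d - s) - eager b.2 a.2 (d - t)| ≤ t - s := fun s t h => by
    have := eager_lip b.2 a.2 (d - s) (d - t)
    rwa [show d - s - (d - t) = t - s by ring, abs_of_nonneg (sub_nonneg.2 h)] at this
  show |eager a.1 b.1 s - eager a.1 b.1 t| +
    |eager b.2 a.2 (d - s) - eager b.2 a.2 (d - t)| ≤ t - s
  have hx : ∀ u, |a.1 - b.1| ≤ u → eager a.1 b.1 u = b.1 := fun u => eager_done _ _ u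
  have hy : ∀ u, u ≤ |a.1 - b.1| → eager b.2 a.2 (d - u) = a.2 := fun u h =>
    eager_done _ _ _ (by linarith)
  rcases le_total t |a.1 - b.1| with h | h
  · rw [hy s (hst.trans h), hy t h]
    simpa using key s t hst
  · rcases le_total s |a.1 - b.1| with h' | h'
    · have k1 := key s _ h'
      have k2 := key2 _ t h
      rw [hx _ le_rfl] at k1
      rw [hy _ le_rfl] at k2
      rw [hx t h, hy s h']
      linarith
    · rw [hx s h', hx t h]
      simpa using key2 s t hst

lemma sched_lip (a b : ℝ × ℝ) (d : ℝ) (hd : l1 (a - b) ≤ d) : Lip1On (sched a b d) d := by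
  intro s _ t _
  rcases le_total s t with h | h
  · rw [abs_sub_comm, abs_of_nonneg (sub_nonneg.2 h)]
    exact sched_lip_le a b d hd s t h
  · rw [abs_of_nonneg (sub_nonneg.2 h)]
    have := sched_lip_le a b d hd t s h
    simp only [l1, Prod.fst_sub, Prod.snd_sub] at this ⊢
    rwa [abs_sub_comm, abs_sub_comm (sched a b d s).2]

lemma sched_turn (a b : ℝ × ℝ) (d : ℝ) (hd : l1 (a - b) ≤ d) : AtMostOneTurn (sched a b d) a b d := by
  intro t ht
  have hb := sched_bound a b d hd
  rcases le_total t |a.1 - b.1| with h | h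
  · left
    have : sched a b d t = (eager a.1 b.1 t, a.2) :=
      Prod.ext rfl (eager_done _ _ _ (by linarith))
    rw [this, show segment ℝ a (b.1, a.2) = segment ℝ (a.1, a.2) (b.1, a.2) from rfl,
      ← Prod.image_mk_segment_left]
    exact ⟨_, eager_mem _ _ _ ht.1, rfl⟩
  · right
    have : sched a b d t = (b.1, eager b.2 a.2 (d - t)) :=
      Prod.ext (eager_done _ _ _ h) rfl
    rw [this, show segment ℝ (b.1, a.2) b = segment ℝ (b.1, a.2) (b.1, b.2) from rfl,
      ← Prod.image_mk_segment_right, segment_symm]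
    exact ⟨_, eager_mem _ _ _ (sub_nonneg.2 ht.2), rfl⟩

theorem stmt0 (a₁ a₂ b₁ b₂ : ℝ × ℝ)
    (hA : Feasible2 a₁ a₂) (hB : Feasible2 b₁ b₂)
    (hord : CommonlyOrdered2 a₁ a₂ b₁ b₂)
    (d : ℝ) (hd : d ≥ max (l1 (a₁ - b₁)) (l1 (a₂ - b₂))) :
    ∃ m₁ m₂ : ℝ → ℝ × ℝ,
      IsSchedule2 m₁ m₂ a₁ a₂ b₁ b₂ d ∧
      AtMostOneTurn m₁ a₁ b₁ d ∧ AtMostOneTurn m₂ a₂ b₂ d := by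
  have h1 := (le_max_left _ _).trans hd
  have h2 := (le_max_right _ _).trans hd
  refine ⟨sched a₁ b₁ d, sched a₂ b₂ d, ⟨?_, sched_zero _ _ _ h1, sched_zero _ _ _ h2,
    sched_end _ _ _ h1, sched_end _ _ _ h2, sched_lip _ _ _ h1, sched_lip _ _ _ h2, ?_⟩,
    sched_turn _ _ _ h1, sched_turn _ _ _ h2⟩
  · exact le_trans (add_nonneg (abs_nonneg _) (abs_nonneg _)) h1
  · intro t _
    show 1 ≤ max |eager a₁.1 b₁.1 t - eager a₂.1 b₂.1 t|
      |eager b₁.2 a₁.2 (d - t) - eager b₂.2 a₂.2 (d - t)|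
    rcases hord with ⟨p, q⟩ | ⟨p, q⟩ | ⟨p, q⟩ | ⟨p, q⟩
    · have := eager_mono _ _ _ _ t p q
      exact le_max_of_le_left (le_abs.2 (Or.inl (by linarith)))
    · have := eager_mono _ _ _ _ t p q
      exact le_max_of_le_left (le_abs.2 (Or.inr (by linarith)))
    · have := eager_mono _ _ _ _ (d - t) q p
      exact le_max_of_le_right (le_abs.2 (Or.inl (by linarith)))
    · have := eager_mono _ _ _ _ (d - t) q p
      exact le_max_of_le_right (le_abs.2 (Or.inr (by linarith)))
end

section
/- Let a₁,a₂,b₁,b₂ ∈ ℝ × ℝ satisfy x(a₁) ≥ x(a₂) + 1 and x(b₁) ≥ x(b₂) + 1, and let d ≥ max(‖a₁ − b₁‖₁, ‖a₂ − b₂‖₁). For i ∈ {1,2} define mᵢ : ℝ → ℝ × ℝ by mᵢ(t) = (x(aᵢ) + sgn(x(bᵢ) − x(aᵢ)) · min(t, |x(bᵢ) − x(aᵢ)|), y(aᵢ) + sgn(y(bᵢ) − y(aᵢ)) · max(0, t − (d − |y(bᵢ) − y(aᵢ)|))), where sgn is the real sign function. Then mᵢ(0) = aᵢ, mᵢ(d)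 = bᵢ, and for every t ∈ [0,d] one has max(|x(m₁(t)) − x(m₂(t))|, |y(m₁(t)) − y(m₂(t))|) ≥ 1 (the schedule that moves each robot first horizontally toward its target, then waits, then moves vertically, is collision-free). -/
/-- The horizontal-then-wait-then-vertical trajectory over `[0,d]` from `a` to `b`:
move along the x-axis toward `x(b)` at unit speed, wait until the elapsed time is
`d - |y(b) - y(a)|`, then move along the y-axis toward `y(b)` at unit speed. -/
noncomputable def hvSched (d : ℝ) (a b : ℝ × ℝ) (t : ℝ) : ℝ × ℝ :=
  (a.1 + Real.sign (b.1 - a.1) * min t |b.1 - a.1|,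
   a.2 + Real.sign (b.2 - a.2) * max 0 (t - (d - |b.2 - a.2|)))

theorem sign_mul_abs_aux (u : ℝ) : Real.sign u * |u| = u := by
  rcases lt_trichotomy u 0 with h | h | h
  · rw [Real.sign_of_neg h, abs_of_neg h]; ring
  · simp [h]
  · rw [Real.sign_of_pos h, abs_of_pos h]; ring

theorem hv_zero_aux (d : ℝ) (a b : ℝ × ℝ) (h : l1 (a - b) ≤ d) : hvSched d a b 0 = a := by
  simp only [l1, Prod.fst_sub, Prod.snd_sub, abs_sub_comm a.1, abs_sub_comm a.2] at h
  have h1 := abs_nonneg (b.1 - a.1)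
  ext
  · simp [hvSched]
  · simp only [hvSched]
    rw [max_eq_left (by linarith)]; ring

theorem hv_end_aux (d : ℝ) (a b : ℝ × ℝ) (h : l1 (a - b) ≤ d) : hvSched d a b d = b := by
  simp only [l1, Prod.fst_sub, Prod.snd_sub, abs_sub_comm a.1, abs_sub_comm a.2] at h
  have h1 := abs_nonneg (b.1 - a.1)
  have h2 := abs_nonneg (b.2 - a.2)
  ext
  · simp only [hvSched]
    rw [min_eq_right (by linarith), sign_mul_abs_aux]; ring
  · simp only [hvSched]
    rw [max_eq_right (by linarith), sub_sub_cancel, sign_mul_abs_aux]; ring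

theorem hv_x_aux (a b t : ℝ) (ht : 0 ≤ t) :
    (a ≤ b ∧ a + Real.sign (b - a) * min t |b - a| = min (a + t) b) ∨
    (b ≤ a ∧ a + Real.sign (b - a) * min t |b - a| = max (a - t) b) := by
  rcases lt_trichotomy (b - a) 0 with h | h | h
  · right
    refine ⟨by linarith, ?_⟩
    rw [Real.sign_of_neg h, abs_of_neg h]
    rcases le_total t (-(b - a)) with h1 | h1
    · rw [min_eq_left h1, max_eq_left (by linarith)]; ring
    · rw [min_eq_right h1, max_eq_right (by linarith)]; ring
  · left
    refine ⟨by linarith, ?_⟩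
    rw [h, Real.sign_zero, min_eq_right (by linarith : b ≤ a + t)]; linarith
  · left
    refine ⟨by linarith, ?_⟩
    rw [Real.sign_of_pos h, abs_of_pos h]
    rcases le_total t (b - a) with h1 | h1
    · rw [min_eq_left h1, min_eq_left (by linarith)]; ring
    · rw [min_eq_right h1, min_eq_right (by linarith)]; ring

theorem stmt1 (a₁ a₂ b₁ b₂ : ℝ × ℝ) (d : ℝ)
    (ha : a₁.1 ≥ a₂.1 + 1) (hb : b₁.1 ≥ b₂.1 + 1)
    (hd : d ≥ max (l1 (a₁ - b₁)) (l1 (a₂ - b₂))) :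
    hvSched d a₁ b₁ 0 = a₁ ∧ hvSched d a₂ b₂ 0 = a₂ ∧
    hvSched d a₁ b₁ d = b₁ ∧ hvSched d a₂ b₂ d = b₂ ∧
    ∀ t ∈ Set.Icc (0:ℝ) d,
      max |(hvSched d a₁ b₁ t).1 - (hvSched d a₂ b₂ t).1|
          |(hvSched d a₁ b₁ t).2 - (hvSched d a₂ b₂ t).2| ≥ 1 := by
  have h₁ := (le_max_left _ _).trans hd
  have h₂ := (le_max_right _ _).trans hd
  refine ⟨hv_zero_aux d _ _ h₁, hv_zero_aux d _ _ h₂, hv_end_aux d _ _ h₁,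
    hv_end_aux d _ _ h₂, fun t ht => ?_⟩
  have ht0 : 0 ≤ t := ht.1
  refine le_trans ?_ (le_max_left _ _)
  refine le_trans ?_ (le_abs_self _)
  simp only [hvSched]
  rcases hv_x_aux a₁.1 b₁.1 t ht0 with ⟨h1, e1⟩ | ⟨h1, e1⟩ <;>
  rcases hv_x_aux a₂.1 b₂.1 t ht0 with ⟨h2, e2⟩ | ⟨h2, e2⟩ <;>
  rw [e1, e2] <;> clear e1 e2 hd h₁ h₂ <;>
  grind
end

section
/- Let a₁,a₂,b₁,b₂ ∈ ℝ × ℝ satisfy y(a₁) ≥ y(a₂) + 1 and y(b₁) ≥ y(b₂) + 1, and let d ≥ max(‖a₁ − b₁‖₁, ‖a₂ − b₂‖₁). For i ∈ {1,2} define mᵢ : ℝ → ℝ × ℝ by mᵢ(t) = (x(aᵢ) + sgn(x(bᵢ) − x(aᵢ)) · min(t, |x(bᵢ) − x(aᵢ)|), y(aᵢ) + sgn(y(bᵢ) − y(aᵢ)) · max(0, t − (d − |y(bᵢ) − y(aᵢ)|))), where sgn is the real sign function. Then mᵢ(0) = aᵢ, mᵢ(d) = bᵢ, and for every t ∈ [0,d]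 one has max(|x(m₁(t)) − x(m₂(t))|, |y(m₁(t)) − y(m₂(t))|) ≥ 1 (the horizontal-then-wait-then-vertical schedule is also collision-free when the two configurations share a vertical ordering). -/
theorem sgn_mul_abs' (v : ℝ) : Real.sign v * |v| = v := by
  rcases lt_trichotomy v 0 with h | h | h
  · rw [Real.sign_of_neg h, abs_of_neg h]; ring
  · simp [h]
  · rw [Real.sign_of_pos h, abs_of_pos h]; ring

theorem hv_ends (d : ℝ) (a b : ℝ × ℝ) (h : l1 (a - b) ≤ d) :
    hvSched d a b 0 = a ∧ hvSched d a b d = b := by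
  simp only [l1, Prod.fst_sub, Prod.snd_sub] at h
  rw [abs_sub_comm a.1, abs_sub_comm a.2] at h
  have h1 := abs_nonneg (b.1 - a.1)
  have h2 := abs_nonneg (b.2 - a.2)
  constructor
  · ext
    · simp [hvSched]
    · simp only [hvSched]
      rw [max_eq_left (by linarith)]; simp
  · ext
    · simp only [hvSched]
      rw [min_eq_right (by linarith), sgn_mul_abs']; ring
    · simp only [hvSched]
      rw [max_eq_right (by linarith), show d - (d - |b.2 - a.2|) = |b.2 - a.2| by ring,
        sgn_mul_abs']; ring

theorem sgn_cases (v s : ℝ) (hs : 0 ≤ s) :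
    (0 ≤ v ∧ v ≤ s ∧ Real.sign v * max 0 (|v| - s) = 0) ∨
    (0 ≤ v ∧ s ≤ v ∧ Real.sign v * max 0 (|v| - s) = v - s) ∨
    (v ≤ 0 ∧ -v ≤ s ∧ Real.sign v * max 0 (|v| - s) = 0) ∨
    (v ≤ 0 ∧ s ≤ -v ∧ Real.sign v * max 0 (|v| - s) = v + s) := by
  rcases lt_trichotomy v 0 with h | h | h
  · rw [Real.sign_of_neg h, abs_of_neg h]
    rcases le_total (-v) s with g | g
    · right; right; left
      rw [max_eq_left (by linarith)]; exact ⟨h.le, g, by ring⟩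
    · right; right; right
      rw [max_eq_right (by linarith)]; exact ⟨h.le, g, by ring⟩
  · left; subst h; simp [hs]
  · rw [Real.sign_of_pos h, abs_of_pos h]
    rcases le_total v s with g | g
    · left
      rw [max_eq_left (by linarith)]; exact ⟨h.le, g, by ring⟩
    · right; left
      rw [max_eq_right (by linarith)]; exact ⟨h.le, g, by ring⟩

theorem stmt2 (a₁ a₂ b₁ b₂ : ℝ × ℝ) (d : ℝ)
    (ha : a₁.2 ≥ a₂.2 + 1) (hb : b₁.2 ≥ b₂.2 + 1)
    (hd : d ≥ max (l1 (a₁ - b₁)) (l1 (a₂ - b₂))) :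
    hvSched d a₁ b₁ 0 = a₁ ∧ hvSched d a₂ b₂ 0 = a₂ ∧
    hvSched d a₁ b₁ d = b₁ ∧ hvSched d a₂ b₂ d = b₂ ∧
    ∀ t ∈ Set.Icc (0:ℝ) d,
      max |(hvSched d a₁ b₁ t).1 - (hvSched d a₂ b₂ t).1|
          |(hvSched d a₁ b₁ t).2 - (hvSched d a₂ b₂ t).2| ≥ 1 := by
  obtain ⟨p1, q1⟩ := hv_ends d a₁ b₁ (le_trans (le_max_left _ _) hd)
  obtain ⟨p2, q2⟩ := hv_ends d a₂ b₂ (le_trans (le_max_right _ _) hd)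
  refine ⟨p1, p2, q1, q2, ?_⟩
  rintro t ⟨-, ht⟩
  refine le_trans (le_trans ?_ (le_abs_self _)) (le_max_right _ _)
  simp only [hvSched]
  rw [show t - (d - |b₁.2 - a₁.2|) = |b₁.2 - a₁.2| - (d - t) by ring,
    show t - (d - |b₂.2 - a₂.2|) = |b₂.2 - a₂.2| - (d - t) by ring]
  have hs : 0 ≤ d - t := by linarith
  rcases sgn_cases (b₁.2 - a₁.2) (d - t) hs with ⟨h1, h2, h3⟩ | ⟨h1, h2, h3⟩ | ⟨h1, h2, h3⟩ | ⟨h1, h2, h3⟩ <;>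
  rcases sgn_cases (b₂.2 - a₂.2) (d - t) hs with ⟨k1, k2, k3⟩ | ⟨k1, k2, k3⟩ | ⟨k1, k2, k3⟩ | ⟨k1, k2, k3⟩ <;>
  rw [h3, k3] <;> linarith
end

section
/- Let k ≥ 1 and let A, B be feasible, commonly ordered configurations of k unit-square robots, and set d = max over i of ‖A i − B i‖₁. Then there exists a feasible schedule m over [0,d] from A to B in which each robot makes at most one turn: for each i, the image of m i on [0,d] is contained in the union of the horizontal segment joining A i to the point (x(B i), y(A i)) and the vertical segment joining (x(B i), y(A i)) to B i. -/
/-- A configuration of `k` unit-square robots is feasible if all robots are pairwise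
interior disjoint. -/
def FeasibleConfig {k : ℕ} (P : Fin k → ℝ × ℝ) : Prop :=
  ∀ i j : Fin k, i ≠ j → max |(P i).1 - (P j).1| |(P i).2 - (P j).2| ≥ 1

/-- `m` is a feasible schedule from configuration `A` to configuration `B` over `[0,T]`:
each robot starts at `A i`, ends at `B i`, moves 1-Lipschitz-ly with respect to the L1
distance, and every intermediate configuration is feasible. -/
def IsScheduleK {k : ℕ} (m : Fin k → ℝ → ℝ × ℝ) (A B : Fin k → ℝ × ℝ) (T : ℝ) : Prop :=
  0 ≤ T ∧ (∀ i, m i 0 = A i) ∧ (∀ i, m i T = B i) ∧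
  (∀ i, ∀ s ∈ Set.Icc (0:ℝ) T, ∀ t ∈ Set.Icc (0:ℝ) T, l1 (m i s - m i t) ≤ |s - t|) ∧
  (∀ t ∈ Set.Icc (0:ℝ) T, FeasibleConfig (fun i => m i t))

/-- The configurations `A` and `B` of `k` robots are commonly ordered: for each pair of
distinct robots, one of the four axis-parallel separations holds simultaneously in `A`
and in `B`. -/
def CommonlyOrderedK {k : ℕ} (A B : Fin k → ℝ × ℝ) : Prop :=
  ∀ i j : Fin k, i ≠ j →
    ((A i).1 ≥ (A j).1 + 1 ∧ (B i).1 ≥ (B j).1 + 1) ∨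
    ((A j).1 ≥ (A i).1 + 1 ∧ (B j).1 ≥ (B i).1 + 1) ∨
    ((A i).2 ≥ (A j).2 + 1 ∧ (B i).2 ≥ (B j).2 + 1) ∨
    ((A j).2 ≥ (A i).2 + 1 ∧ (B j).2 ≥ (B i).2 + 1)

/-- Move from `a` towards `b` at unit speed, stopping at `b`. -/
noncomputable def cl (a b t : ℝ) : ℝ := max (a - t) (min (a + t) b)

lemma cl_zero (a b : ℝ) : cl a b 0 = a := by
  unfold cl; simp

lemma cl_of_le {a b t : ℝ} (h : |b - a| ≤ t) : cl a b t = b := by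
  unfold cl
  obtain ⟨h1, h2⟩ := abs_le.mp h
  rw [min_eq_right (by linarith), max_eq_right (by linarith)]

lemma cl_order {a b a' b' : ℝ} (t : ℝ) (h : a ≥ a' + 1) (h' : b ≥ b' + 1) :
    cl a b t ≥ cl a' b' t + 1 := by
  unfold cl
  rw [ge_iff_le, ← max_add_add_right, ← min_add_add_right]
  exact max_le_max (by linarith) (min_le_min (by linarith) h')

lemma cl_lip (a b : ℝ) {s t : ℝ} (h0 : 0 ≤ s) (h : s ≤ t) :
    |cl a b s - cl a b t| ≤ min t |b - a| - min s |b - a| := by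
  unfold cl
  rcases le_total a b with hab | hab
  · rw [abs_of_nonneg (show 0 ≤ b - a by linarith), abs_le]
    grind
  · rw [abs_of_nonpos (show b - a ≤ 0 by linarith), abs_le]
    grind

lemma cl_mem (a b : ℝ) {t : ℝ} (h0 : 0 ≤ t) : cl a b t ∈ segment ℝ a b := by
  rw [segment_eq_uIcc, Set.mem_uIcc]
  unfold cl
  grind

theorem stmt3 (k : ℕ) (hk : 1 ≤ k) (A B : Fin k → ℝ × ℝ)
    (hA : FeasibleConfig A) (hB : FeasibleConfig B)
    (hord : CommonlyOrderedK A B)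
    (d : ℝ) (hd : IsGreatest (Set.range fun i => l1 (A i - B i)) d) :
    ∃ m : Fin k → ℝ → ℝ × ℝ, IsScheduleK m A B d ∧
      ∀ i, ∀ t ∈ Set.Icc (0:ℝ) d,
        m i t ∈ segment ℝ (A i) ((B i).1, (A i).2) ∪ segment ℝ ((B i).1, (A i).2) (B i) := by
  have hle : ∀ i, |(B i).1 - (A i).1| + |(A i).2 - (B i).2| ≤ d := by
    intro i
    have := hd.2 ⟨i, rfl⟩
    simp only [l1, Prod.fst_sub, Prod.snd_sub] at this
    rwa [abs_sub_comm (B i).1]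
  have hd0 : 0 ≤ d := le_trans (by positivity) (hle ⟨0, hk⟩)
  refine ⟨fun i t => (cl (A i).1 (B i).1 t, cl (B i).2 (A i).2 (d - t)),
    ⟨hd0, ?_, ?_, ?_, ?_⟩, ?_⟩
  · intro i
    have := hle i
    have := abs_nonneg ((B i).1 - (A i).1)
    ext
    · exact cl_zero _ _
    · exact cl_of_le (by linarith)
  · intro i
    have := hle i
    have := abs_nonneg ((A i).2 - (B i).2)
    ext
    · exact cl_of_le (by linarith)
    · simp [cl_zero]
  · intro i
    have key : ∀ s t : ℝ, 0 ≤ s → s ≤ t → t ≤ d →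
        |cl (A i).1 (B i).1 s - cl (A i).1 (B i).1 t| +
        |cl (B i).2 (A i).2 (d - s) - cl (B i).2 (A i).2 (d - t)| ≤ |s - t| := by
      intro s t hs hst ht
      have h1 := cl_lip (A i).1 (B i).1 hs hst
      have h2 := cl_lip (B i).2 (A i).2 (sub_nonneg.2 ht) (sub_le_sub_left hst d)
      rw [abs_sub_comm] at h2
      have h3 := hle i
      rw [abs_of_nonpos (show s - t ≤ 0 by linarith)]
      generalize |(B i).1 - (A i).1| = c at *
      generalize |(A i).2 - (B i).2| = e at *
      refine (add_le_add h1 h2).trans ?_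
      grind
    intro s hs t ht
    simp only [l1, Prod.fst_sub, Prod.snd_sub]
    rcases le_total s t with h | h
    · exact key s t hs.1 h ht.2
    · have := key t s ht.1 h hs.2
      rw [abs_sub_comm s t, abs_sub_comm (cl (A i).1 (B i).1 s),
        abs_sub_comm (cl (B i).2 (A i).2 (d - s))]
      exact this
  · intro t ht i j hij
    simp only
    rcases hord i j hij with h | h | h | h
    · have := cl_order t h.1 h.2
      exact le_max_of_le_left (le_trans (by linarith) (le_abs_self _))
    · have := cl_order t h.1 h.2
      exact le_max_of_le_left (le_trans (by linarith) (neg_le_abs _))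
    · have := cl_order (d - t) h.2 h.1
      exact le_max_of_le_right (le_trans (by linarith) (le_abs_self _))
    · have := cl_order (d - t) h.2 h.1
      exact le_max_of_le_right (le_trans (by linarith) (neg_le_abs _))
  · intro i t ht
    have := hle i
    rcases le_total t |(B i).1 - (A i).1| with h | h
    · left
      have h2 : cl (B i).2 (A i).2 (d - t) = (A i).2 := cl_of_le (by linarith)
      simp only [h2]
      have := Prod.image_mk_segment_left (𝕜 := ℝ) (A i).1 (B i).1 (A i).2
      rw [show A i = ((A i).1, (A i).2) from rfl, ← this]
      exact ⟨_, cl_mem _ _ ht.1, rfl⟩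
    · right
      have h2 : cl (A i).1 (B i).1 t = (B i).1 := cl_of_le h
      simp only [h2]
      have := Prod.image_mk_segment_right (𝕜 := ℝ) (B i).1 (A i).2 (B i).2
      rw [show segment ℝ ((B i).1, (A i).2) (B i)
        = segment ℝ ((B i).1, (A i).2) ((B i).1, (B i).2) from rfl, ← this]
      refine ⟨_, ?_, rfl⟩
      rw [segment_symm]
      exact cl_mem _ _ (sub_nonneg.2 ht.2)
end

section
/- Let (a₁,a₂) and (b₁,b₂) be feasible, commonly ordered two-robot configurations. Then there exist T ≥ 0 and a feasible schedule (m₁, m₂) over [0,T] from (a₁,a₂) to (b₁,b₂) such that for each i ∈ {1,2} the L1 length of mᵢ over [0,T] equals ‖aᵢ − bᵢ‖₁ (so the total traveled length equals ‖a₁ − b₁‖₁ + ‖a₂ − b₂‖₁) and each robot makes at most one turn: the image of mᵢ on [0,T] is contained in the union of the horizontal segment joining aᵢ to (x(bᵢ), y(aᵢ)) and the vertical segment joining (x(bᵢ), y(aᵢ)) to bᵢ. -/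
/-- The L1 length of a trajectory over `[0,T]`: its total variation on `[0,T]`
with respect to the L1 distance on the plane. -/
noncomputable def l1Length (m : ℝ → ℝ × ℝ) (T : ℝ) : ENNReal :=
  eVariationOn (fun t => (WithLp.equiv 1 (ℝ × ℝ)).symm (m t)) (Set.Icc 0 T)

/-- Progress of the horizontal phase. -/
noncomputable def uu (K t : ℝ) : ℝ := min (t / K) 1

/-- Progress of the vertical phase. -/
noncomputable def vv (K t : ℝ) : ℝ := max (t / K - 1) 0

/-- Horizontal-then-vertical motion from `a` to `b`. -/
noncomputable def mot (K : ℝ) (a b : ℝ × ℝ) (t : ℝ) : ℝ × ℝ :=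
  (a.1 + uu K t * (b.1 - a.1), a.2 + vv K t * (b.2 - a.2))

lemma uu_add_vv (K t : ℝ) : uu K t + vv K t = t / K := by
  unfold uu vv
  rcases le_total (t / K) 1 with h | h
  · rw [min_eq_left h, max_eq_right (by linarith)]; ring
  · rw [min_eq_right h, max_eq_left (by linarith)]; ring

lemma uu_mono {K s t : ℝ} (hK : 0 < K) (h : s ≤ t) : uu K s ≤ uu K t := by
  unfold uu; gcongr

lemma vv_mono {K s t : ℝ} (hK : 0 < K) (h : s ≤ t) : vv K s ≤ vv K t := by
  unfold vv; gcongr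

lemma uu_vv_facts {K t : ℝ} (hK : 0 < K) (ht : t ∈ Set.Icc (0:ℝ) (2 * K)) :
    0 ≤ uu K t ∧ uu K t ≤ 1 ∧ 0 ≤ vv K t ∧ vv K t ≤ 1 ∧ (vv K t = 0 ∨ uu K t = 1) := by
  obtain ⟨h0, h1⟩ := ht
  have h2 : 0 ≤ t / K := by positivity
  have h3 : t / K ≤ 2 := by rw [div_le_iff₀ hK]; exact h1
  unfold uu vv
  refine ⟨le_min h2 zero_le_one, min_le_right _ _, le_max_right _ _,
    max_le (by linarith) zero_le_one, ?_⟩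
  rcases le_total (t / K) 1 with h | h
  · left; exact max_eq_right (by linarith)
  · right; exact min_eq_right h

lemma mot_dist {K s t : ℝ} (hK : 0 < K) (a b : ℝ × ℝ) (h : s ≤ t) :
    l1 (mot K a b t - mot K a b s) =
      (uu K t - uu K s) * |b.1 - a.1| + (vv K t - vv K s) * |b.2 - a.2| := by
  have h1 := uu_mono hK h
  have h2 := vv_mono hK h
  unfold l1 mot
  simp only [Prod.fst_sub, Prod.snd_sub]
  rw [show a.1 + uu K t * (b.1 - a.1) - (a.1 + uu K s * (b.1 - a.1)) =
      (uu K t - uu K s) * (b.1 - a.1) by ring,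
    show a.2 + vv K t * (b.2 - a.2) - (a.2 + vv K s * (b.2 - a.2)) =
      (vv K t - vv K s) * (b.2 - a.2) by ring, abs_mul, abs_mul,
    abs_of_nonneg (sub_nonneg.2 h1), abs_of_nonneg (sub_nonneg.2 h2)]

lemma l1_sub_comm (p q : ℝ × ℝ) : l1 (p - q) = l1 (q - p) := by
  unfold l1
  simp only [Prod.fst_sub, Prod.snd_sub]
  rw [abs_sub_comm p.1, abs_sub_comm p.2]

lemma mot_lip {K : ℝ} (hK : 0 < K) (a b : ℝ × ℝ) (hx : |b.1 - a.1| ≤ K)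
    (hy : |b.2 - a.2| ≤ K) (T : ℝ) : Lip1On (mot K a b) T := by
  have key : ∀ s t : ℝ, s ≤ t → l1 (mot K a b t - mot K a b s) ≤ t - s := by
    intro s t h
    rw [mot_dist hK a b h]
    have h1 := uu_mono hK h
    have h2 := vv_mono hK h
    have e : (uu K t - uu K s) * K + (vv K t - vv K s) * K = t - s := by
      have e1 := uu_add_vv K t
      have e2 := uu_add_vv K s
      have e3 : t / K * K = t := div_mul_cancel₀ _ hK.ne'
      have e4 : s / K * K = s := div_mul_cancel₀ _ hK.ne'
      rw [← e1] at e3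
      rw [← e2] at e4
      linarith
    have h3 := mul_le_mul_of_nonneg_left hx (sub_nonneg.2 h1)
    have h4 := mul_le_mul_of_nonneg_left hy (sub_nonneg.2 h2)
    linarith
  intro s _ t _
  rcases le_total s t with h | h
  · rw [l1_sub_comm, abs_sub_comm, abs_of_nonneg (sub_nonneg.2 h)]; exact key s t h
  · rw [abs_of_nonneg (sub_nonneg.2 h)]; exact key t s h

lemma edist_l1 (p q : ℝ × ℝ) :
    edist ((WithLp.equiv 1 (ℝ × ℝ)).symm p) ((WithLp.equiv 1 (ℝ × ℝ)).symm q) =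
      ENNReal.ofReal (l1 (p - q)) := by
  rw [WithLp.prod_edist_eq_add (by simp)]
  simp [l1, edist_dist, Real.dist_eq, ENNReal.ofReal_add]

lemma mot_zero {K : ℝ} (a b : ℝ × ℝ) : mot K a b 0 = a := by
  simp [mot, uu, vv]

lemma mot_end {K : ℝ} (hK : 0 < K) (a b : ℝ × ℝ) : mot K a b (2 * K) = b := by
  have : 2 * K / K = 2 := by field_simp
  ext <;> simp [mot, uu, vv, this] <;> norm_num

lemma mot_length {K : ℝ} (hK : 0 < K) (a b : ℝ × ℝ) :
    l1Length (mot K a b) (2 * K) = ENNReal.ofReal (l1 (a - b)) := by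
  unfold l1Length
  set f : ℝ → ℝ := fun t => uu K t * |b.1 - a.1| + vv K t * |b.2 - a.2| with hf
  have hd : ∀ s t, s ≤ t → l1 (mot K a b t - mot K a b s) = f t - f s := by
    intro s t h
    rw [mot_dist hK a b h, hf]; ring
  have hm : Monotone f := by
    intro s t h
    have := uu_mono hK h
    have := vv_mono hK h
    simp only [hf]
    gcongr
  have e : eVariationOn (fun t => (WithLp.equiv 1 (ℝ × ℝ)).symm (mot K a b t))
      (Set.Icc 0 (2 * K)) = eVariationOn f (Set.Icc 0 (2 * K)) := by
    unfold eVariationOn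
    congr 1 with p : 1
    congr 1 with i : 1
    have hi : p.2.1 i ≤ p.2.1 (i + 1) := p.2.2.1 (Nat.le_succ i)
    rw [edist_l1, hd _ _ hi, edist_dist, Real.dist_eq, abs_of_nonneg (sub_nonneg.2 (hm hi))]
  have h2 := (hm.monotoneOn Set.univ).eVariationOn_eq (Set.mem_univ 0) (Set.mem_univ (2 * K))
  rw [Set.univ_inter] at h2
  rw [e, h2, ← hd 0 (2 * K) (by linarith), mot_zero, mot_end hK, l1_sub_comm]

lemma mot_turn {K : ℝ} (hK : 0 < K) (a b : ℝ × ℝ) :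
    AtMostOneTurn (mot K a b) a b (2 * K) := by
  intro t ht
  obtain ⟨u0, u1, v0, v1, h | h⟩ := uu_vv_facts hK ht
  · left
    refine ⟨1 - uu K t, uu K t, by linarith, u0, by ring, ?_⟩
    ext <;> simp [mot, h] <;> ring
  · right
    refine ⟨1 - vv K t, vv K t, by linarith, v0, by ring, ?_⟩
    ext <;> simp [mot, h] <;> ring

lemma interp_ge {u p q r s : ℝ} (h0 : 0 ≤ u) (h1 : u ≤ 1) (hpq : p ≥ q + 1) (hrs : r ≥ s + 1) :
    1 ≤ (p + u * (r - p)) - (q + u * (s - q)) := by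
  nlinarith [mul_nonneg h0 (sub_nonneg.2 hrs), mul_nonneg (sub_nonneg.2 h1) (sub_nonneg.2 hpq)]

lemma mot_feasible {K : ℝ} (hK : 0 < K) (a₁ a₂ b₁ b₂ : ℝ × ℝ)
    (hord : CommonlyOrdered2 a₁ a₂ b₁ b₂) (t : ℝ) (ht : t ∈ Set.Icc (0:ℝ) (2 * K)) :
    Feasible2 (mot K a₁ b₁ t) (mot K a₂ b₂ t) := by
  obtain ⟨u0, u1, v0, v1, -⟩ := uu_vv_facts hK ht
  unfold Feasible2 mot
  rcases hord with ⟨h, h'⟩ | ⟨h, h'⟩ | ⟨h, h'⟩ | ⟨h, h'⟩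
  · exact le_max_of_le_left ((interp_ge u0 u1 h h').trans (le_abs_self _))
  · rw [abs_sub_comm]
    exact le_max_of_le_left ((interp_ge u0 u1 h h').trans (le_abs_self _))
  · exact le_max_of_le_right ((interp_ge v0 v1 h h').trans (le_abs_self _))
  · refine le_max_of_le_right ?_
    rw [abs_sub_comm]
    exact (interp_ge v0 v1 h h').trans (le_abs_self _)

theorem stmt4 (a₁ a₂ b₁ b₂ : ℝ × ℝ)
    (hA : Feasible2 a₁ a₂) (hB : Feasible2 b₁ b₂)
    (hord : CommonlyOrdered2 a₁ a₂ b₁ b₂) :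
    ∃ T ≥ (0:ℝ), ∃ m₁ m₂ : ℝ → ℝ × ℝ,
      IsSchedule2 m₁ m₂ a₁ a₂ b₁ b₂ T ∧
      l1Length m₁ T = ENNReal.ofReal (l1 (a₁ - b₁)) ∧
      l1Length m₂ T = ENNReal.ofReal (l1 (a₂ - b₂)) ∧
      AtMostOneTurn m₁ a₁ b₁ T ∧ AtMostOneTurn m₂ a₂ b₂ T := by
  obtain ⟨K, hK, h1, h2, h3, h4⟩ : ∃ K : ℝ, 0 < K ∧ |b₁.1 - a₁.1| ≤ K ∧ |b₁.2 - a₁.2| ≤ K ∧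
      |b₂.1 - a₂.1| ≤ K ∧ |b₂.2 - a₂.2| ≤ K := by
    have := abs_nonneg (b₁.1 - a₁.1)
    have := abs_nonneg (b₁.2 - a₁.2)
    have := abs_nonneg (b₂.1 - a₂.1)
    have := abs_nonneg (b₂.2 - a₂.2)
    refine ⟨1 + |b₁.1 - a₁.1| + |b₁.2 - a₁.2| + |b₂.1 - a₂.1| + |b₂.2 - a₂.2|,
      ?_, ?_, ?_, ?_, ?_⟩ <;> linarith
  have hT : (0:ℝ) ≤ 2 * K := by linarith
  exact ⟨2 * K, hT, mot K a₁ b₁, mot K a₂ b₂,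
    ⟨hT, mot_zero _ _, mot_zero _ _, mot_end hK _ _, mot_end hK _ _,
      mot_lip hK _ _ h1 h2 _, mot_lip hK _ _ h3 h4 _, mot_feasible hK _ _ _ _ hord⟩,
    mot_length hK _ _, mot_length hK _ _, mot_turn hK _ _, mot_turn hK _ _⟩
end

section
/- Let k ≥ 1 and let A, B be feasible, commonly ordered configurations of k unit-square robots, and set d = max over i of ‖A i − B i‖₁. Then there exists a feasible schedule m over [0,d] from A to B such that for every i the L1 length of m i over [0,d] equals ‖A i − B i‖₁. In particular this single schedule simultaneously attains makespan max_i ‖A i − B i‖₁ and total traveled length Σ_i ‖A i − B i‖₁. -/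
lemma l1_smul (c : ℝ) (p : ℝ × ℝ) : l1 (c • p) = |c| * l1 p := by
  simp [l1, abs_mul, mul_add]

lemma l1Length_affine (a v : ℝ × ℝ) (d : ℝ) (hd : 0 ≤ d) (h0 : d = 0 → l1 v = 0) :
    l1Length (fun t => a + (t / d) • v) d = ENNReal.ofReal (l1 v) := by
  have hl : 0 ≤ l1 v := by unfold l1; positivity
  have hE : ∀ s t : ℝ, edist ((WithLp.equiv 1 (ℝ × ℝ)).symm (a + (s / d) • v))
      ((WithLp.equiv 1 (ℝ × ℝ)).symm (a + (t / d) • v))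
      = edist (s / d * l1 v) (t / d * l1 v) := by
    intro s t
    rw [edist_l1, edist_dist, Real.dist_eq, ← sub_mul, abs_mul, abs_of_nonneg hl, ← l1_smul]
    congr 2
    rw [sub_smul]; abel
  have h1 : l1Length (fun t => a + (t / d) • v) d
      = eVariationOn (fun t : ℝ => t / d * l1 v) (Set.Icc 0 d) := by
    unfold l1Length eVariationOn
    simp only [hE]
  have hend : d / d * l1 v = l1 v := by
    by_cases h : d = 0
    · simp [h0 h]
    · field_simp
  have hm : MonotoneOn (fun t : ℝ => t / d * l1 v) (Set.Icc 0 d) := by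
    intro s _ t _ hst
    dsimp only
    gcongr
  rw [h1]
  have hl0 : (0:ℝ) ∈ Set.Icc 0 d := ⟨le_rfl, hd⟩
  have hld : d ∈ Set.Icc 0 d := ⟨hd, le_rfl⟩
  apply le_antisymm
  · have := hm.eVariationOn_le hl0 hld
    simpa [hend] using this
  · have := eVariationOn.edist_le (fun t : ℝ => t / d * l1 v) hld hl0
    simpa [hend, edist_dist, Real.dist_eq, abs_of_nonneg hl] using this

lemma lin_sep {a b a' b' c : ℝ} (h0 : 0 ≤ c) (h1 : c ≤ 1) (h : a ≥ b + 1) (h' : a' ≥ b' + 1) :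
    1 ≤ (a + c * (a' - a)) - (b + c * (b' - b)) := by
  nlinarith [mul_nonneg h0 (sub_nonneg.2 h'), mul_nonneg (sub_nonneg.2 h1) (sub_nonneg.2 h)]

theorem stmt5 (k : ℕ) (hk : 1 ≤ k) (A B : Fin k → ℝ × ℝ)
    (hA : FeasibleConfig A) (hB : FeasibleConfig B)
    (hord : CommonlyOrderedK A B)
    (d : ℝ) (hd : IsGreatest (Set.range fun i => l1 (A i - B i)) d) :
    ∃ m : Fin k → ℝ → ℝ × ℝ, IsScheduleK m A B d ∧
      (∀ i, l1Length (m i) d = ENNReal.ofReal (l1 (A i - B i))) ∧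
      (∑ i, l1Length (m i) d) = ENNReal.ofReal (∑ i, l1 (A i - B i)) := by
  have hnn : ∀ p : ℝ × ℝ, 0 ≤ l1 p := fun p => by unfold l1; positivity
  have hsymm : ∀ i, l1 (B i - A i) = l1 (A i - B i) := by
    intro i
    simp [l1, abs_sub_comm]
  have hle : ∀ i, l1 (A i - B i) ≤ d := fun i => hd.2 ⟨i, rfl⟩
  have hd0 : 0 ≤ d := (hnn _).trans (hle ⟨0, hk⟩)
  have hz : ∀ i, d = 0 → l1 (B i - A i) = 0 := fun i h =>
    le_antisymm (by rw [hsymm]; exact (hle i).trans h.le) (hnn _)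
  have hlen : ∀ i, l1Length (fun t => A i + (t / d) • (B i - A i)) d
      = ENNReal.ofReal (l1 (A i - B i)) := fun i => by
    rw [l1Length_affine _ _ _ hd0 (hz i), hsymm]
  refine ⟨fun i t => A i + (t / d) • (B i - A i), ⟨hd0, ?_, ?_, ?_, ?_⟩, hlen, ?_⟩
  · intro i; simp
  · intro i
    by_cases h : d = 0
    · have h2 := hz i h
      unfold l1 at h2
      have e1 : (B i - A i).1 = 0 := abs_eq_zero.1 (by
        linarith [abs_nonneg (B i - A i).1, abs_nonneg (B i - A i).2])
      have e2 : (B i - A i).2 = 0 := abs_eq_zero.1 (by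
        linarith [abs_nonneg (B i - A i).1, abs_nonneg (B i - A i).2])
      have e : B i - A i = 0 := Prod.ext e1 e2
      simp [e, (sub_eq_zero.1 e)]
    · simp [h]
  · intro i s _ t _
    have e : A i + (s / d) • (B i - A i) - (A i + (t / d) • (B i - A i))
        = ((s - t) / d) • (B i - A i) := by
      rw [sub_div, sub_smul]; abel
    dsimp only
    rw [e, l1_smul, hsymm, abs_div, abs_of_nonneg hd0, div_mul_eq_mul_div]
    exact div_le_of_le_mul₀ hd0 (abs_nonneg _) (mul_le_mul_of_nonneg_left (hle i) (abs_nonneg _))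
  · intro t ht i j hij
    have c0 : 0 ≤ t / d := div_nonneg ht.1 hd0
    have c1 : t / d ≤ 1 := div_le_one_of_le₀ ht.2 hd0
    simp only [Prod.fst_add, Prod.snd_add, Prod.smul_fst, Prod.smul_snd, Prod.fst_sub,
      Prod.snd_sub, smul_eq_mul]
    rcases hord i j hij with h | h | h | h
    · exact le_max_of_le_left ((lin_sep c0 c1 h.1 h.2).trans (le_abs_self _))
    · rw [abs_sub_comm]
      exact le_max_of_le_left ((lin_sep c0 c1 h.1 h.2).trans (le_abs_self _))
    · exact le_max_of_le_right ((lin_sep c0 c1 h.1 h.2).trans (le_abs_self _))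
    · refine le_max_of_le_right ?_
      rw [abs_sub_comm]
      exact (lin_sep c0 c1 h.1 h.2).trans (le_abs_self _)
  · rw [ENNReal.ofReal_sum_of_nonneg (fun i _ => hnn _)]
    exact Finset.sum_congr rfl fun i _ => hlen i
end

section
/- Let k ≥ 1 and let A, B be feasible configurations of k unit-square robots. (i) Every feasible schedule from A to B over [0,T] satisfies T ≥ max over i of ‖A i − B i‖₁. (ii) If moreover A and B are commonly ordered, then there exists a feasible schedule from A to B over [0,T] with T = max over i of ‖A i − B i‖₁. Consequently, for commonly ordered configurations the minimum achievable makespan equals the diameter diam(A,B) = max_i ‖A i − B i‖₁. -/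
theorem stmt8 (k : ℕ) (hk : 1 ≤ k) (A B : Fin k → ℝ × ℝ)
    (hA : FeasibleConfig A) (hB : FeasibleConfig B)
    (d : ℝ) (hd : IsGreatest (Set.range fun i => l1 (A i - B i)) d) :
    (∀ (T : ℝ) (m : Fin k → ℝ → ℝ × ℝ), IsScheduleK m A B T → T ≥ d) ∧
    (CommonlyOrderedK A B → ∃ m : Fin k → ℝ → ℝ × ℝ, IsScheduleK m A B d) := by
  obtain ⟨⟨i₀, hi₀⟩, hub⟩ := hd
  have hle : ∀ i, l1 (A i - B i) ≤ d := fun i => hub ⟨i, rfl⟩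
  have hd0 : 0 ≤ d := by
    rw [← hi₀]
    simp only [l1]
    positivity
  refine ⟨?_, ?_⟩
  · rintro T m ⟨hT, h0, h1, hL, -⟩
    have h := hL i₀ 0 ⟨le_refl _, hT⟩ T ⟨hT, le_refl _⟩
    rw [h0, h1, zero_sub, abs_neg, abs_of_nonneg hT] at h
    simp only at hi₀
    linarith
  · intro hc
    refine ⟨fun i t => A i + (t / d) • (B i - A i), hd0, ?_, ?_, ?_, ?_⟩
    · intro i
      simp
    · intro i
      rcases hd0.eq_or_lt with h | h
      · have h2 := hle i
        simp only [l1, Prod.fst_sub, Prod.snd_sub] at h2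
        have e1 : (A i).1 - (B i).1 = 0 := by
          rw [← abs_eq_zero]
          linarith [abs_nonneg ((A i).1 - (B i).1), abs_nonneg ((A i).2 - (B i).2)]
        have e2 : (A i).2 - (B i).2 = 0 := by
          rw [← abs_eq_zero]
          linarith [abs_nonneg ((A i).1 - (B i).1), abs_nonneg ((A i).2 - (B i).2)]
        have e : A i = B i := Prod.ext (by linarith) (by linarith)
        simp [e]
      · simp [div_self h.ne']
    · intro i s _ t _
      have h2 := hle i
      have e : l1 (A i + (s / d) • (B i - A i) - (A i + (t / d) • (B i - A i)))
          = |s / d - t / d| * l1 (A i - B i) := by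
        simp only [l1, Prod.fst_sub, Prod.snd_sub, Prod.fst_add, Prod.snd_add, Prod.smul_fst,
          Prod.smul_snd, smul_eq_mul]
        rw [mul_add, ← abs_mul, ← abs_mul]
        congr 1
        · rw [← abs_neg]
          congr 1
          ring
        · rw [← abs_neg]
          congr 1
          ring
      show l1 (A i + (s / d) • (B i - A i) - (A i + (t / d) • (B i - A i))) ≤ |s - t|
      rw [e, ← sub_div, abs_div, abs_of_nonneg hd0]
      calc |s - t| / d * l1 (A i - B i) ≤ |s - t| / d * d := by gcongr
        _ ≤ |s - t| := by
          rcases hd0.eq_or_lt with h | h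
          · rw [← h, mul_zero]
            exact abs_nonneg _
          · rw [div_mul_cancel₀ _ h.ne']
    · rintro t ⟨ht0, htd⟩ i j hij
      have hr0 : 0 ≤ t / d := div_nonneg ht0 hd0
      have hr1 : t / d ≤ 1 := div_le_one_of_le₀ htd hd0
      simp only [Prod.fst_sub, Prod.snd_sub, Prod.fst_add, Prod.snd_add, Prod.smul_fst,
          Prod.smul_snd, smul_eq_mul]
      generalize t / d = r at hr0 hr1
      have key : ∀ a b a' b' : ℝ, a ≥ a' + 1 → b ≥ b' + 1 →
          1 ≤ (a + r * (b - a)) - (a' + r * (b' - a')) := by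
        intro a b a' b' h1 h2
        nlinarith [mul_nonneg hr0 (sub_nonneg.2 h2), mul_nonneg (sub_nonneg.2 hr1) (sub_nonneg.2 h1)]
      rcases hc i j hij with ⟨h1, h2⟩ | ⟨h1, h2⟩ | ⟨h1, h2⟩ | ⟨h1, h2⟩
      · exact le_max_of_le_left ((key _ _ _ _ h1 h2).trans (le_abs_self _))
      · rw [abs_sub_comm]
        exact le_max_of_le_left ((key _ _ _ _ h1 h2).trans (le_abs_self _))
      · exact le_max_of_le_right ((key _ _ _ _ h1 h2).trans (le_abs_self _))
      · rw [abs_sub_comm (_ + r * ((B i).2 - _))]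
        exact le_max_of_le_right ((key _ _ _ _ h1 h2).trans (le_abs_self _))
end

section
/- Let (m₁, m₂) be a feasible schedule over [0,T] from (a₁,a₂) to (b₁,b₂) with each mᵢ continuous on [0,T], such that (a₁,a₂) ∈ F↑ (y(a₁) ≥ y(a₂)+1), (b₁,b₂) ∈ F→ (x(b₁) ≥ x(b₂)+1), and for every t ∈ [0,T] the configuration (m₁(t), m₂(t)) lies in F↑ ∪ F→. Then there exists t* ∈ [0,T] such that the configuration I = (i₁, i₂) = (m₁(t*), m₂(t*)) is diagonal, i.e. x(i₁) ≥ x(i₂)+1 and y(i₁) ≥ y(i₂)+1, and T ≥ max(‖a₁ − i₁‖₁, ‖a₂ − i₂‖₁) + max(‖i₁ − b₁‖₁, ‖i₂ − b₂‖₁). -/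
theorem stmt10 (a₁ a₂ b₁ b₂ : ℝ × ℝ) (T : ℝ) (m₁ m₂ : ℝ → ℝ × ℝ)
    (hsch : IsSchedule2 m₁ m₂ a₁ a₂ b₁ b₂ T)
    (hc₁ : ContinuousOn m₁ (Set.Icc 0 T)) (hc₂ : ContinuousOn m₂ (Set.Icc 0 T))
    (hstart : a₁.2 ≥ a₂.2 + 1) (hend : b₁.1 ≥ b₂.1 + 1)
    (hall : ∀ t ∈ Set.Icc (0:ℝ) T,
      (m₁ t).1 ≥ (m₂ t).1 + 1 ∨ (m₁ t).2 ≥ (m₂ t).2 + 1) :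
    ∃ t ∈ Set.Icc (0:ℝ) T,
      (m₁ t).1 ≥ (m₂ t).1 + 1 ∧ (m₁ t).2 ≥ (m₂ t).2 + 1 ∧
      T ≥ max (l1 (a₁ - m₁ t)) (l1 (a₂ - m₂ t)) +
          max (l1 (m₁ t - b₁)) (l1 (m₂ t - b₂)) := by
  obtain ⟨hT, h1, h2, h3, h4, L1, L2, -⟩ := hsch
  have m0 : (0:ℝ) ∈ Set.Icc (0:ℝ) T := ⟨le_refl _, hT⟩
  have mT : T ∈ Set.Icc (0:ℝ) T := ⟨hT, le_refl _⟩
  have key : ∃ t ∈ Set.Icc (0:ℝ) T,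
      (m₁ t).1 ≥ (m₂ t).1 + 1 ∧ (m₁ t).2 ≥ (m₂ t).2 + 1 := by
    by_cases c0 : (m₁ 0).1 ≥ (m₂ 0).1 + 1
    · exact ⟨0, m0, c0, by rw [h1, h2]; exact hstart⟩
    by_cases cT : (m₁ T).2 ≥ (m₂ T).2 + 1
    · exact ⟨T, mT, by rw [h3, h4]; exact hend, cT⟩
    have hc : ContinuousOn
        (fun t => ((m₁ t).1 - (m₂ t).1) - ((m₁ t).2 - (m₂ t).2)) (Set.Icc 0 T) :=
      (hc₁.fst.sub hc₂.fst).sub (hc₁.snd.sub hc₂.snd)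
    have e0 := hstart
    have eT := hend
    rw [← h1, ← h2] at e0
    rw [← h3, ← h4] at eT
    push Not at c0 cT
    obtain ⟨t, ht, h⟩ := intermediate_value_Icc hT hc
      (show (0:ℝ) ∈ _ from ⟨by linarith, by linarith⟩)
    dsimp only at h
    refine ⟨t, ht, ?_⟩
    rcases hall t ht with h' | h'
    · exact ⟨h', by linarith⟩
    · exact ⟨by linarith, h'⟩
  obtain ⟨t, ht, hx, hy⟩ := key
  refine ⟨t, ht, hx, hy, ?_⟩
  have A1 := L1 0 m0 t ht
  have A2 := L2 0 m0 t ht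
  have B1 := L1 t ht T mT
  have B2 := L2 t ht T mT
  have e1 : |0 - t| = t := by rw [zero_sub, abs_neg, abs_of_nonneg ht.1]
  have e2 : |t - T| = T - t := by rw [abs_sub_comm, abs_of_nonneg (by linarith [ht.2])]
  rw [e1] at A1 A2
  rw [e2] at B1 B2
  rw [h1] at A1
  rw [h2] at A2
  rw [h3] at B1
  rw [h4] at B2
  have := max_le A1 A2
  have := max_le B1 B2
  linarith
end

section
/- Let (a₁,a₂) and (b₁,b₂) be feasible two-robot configurations with (a₁,a₂) ∈ F↑ (y(a₁) ≥ y(a₂)+1) and (b₁,b₂) ∈ F→ (x(b₁) ≥ x(b₂)+1), and let I = (i₁,i₂) be any feasible diagonal configuration, i.e. one with x(i₁) ≥ x(i₂)+1 and y(i₁) ≥ y(i₂)+1. Then there exists a feasible schedule from (a₁,a₂) to (b₁,b₂) over [0,T] with makespan T = max(‖a₁ − i₁‖₁, ‖a₂ − i₂‖₁) + max(‖i₁ − b₁‖₁, ‖i₂ − b₂‖₁), obtained by passing through the intermediate configuration I. -/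
/-- Straight motion from `a` to `i` in time `D`, then from `i` to `b` in time `E`. -/
noncomputable def pathVia (D E : ℝ) (a i b : ℝ × ℝ) (t : ℝ) : ℝ × ℝ :=
  (a.1 + min t D / D * (i.1 - a.1) + max (t - D) 0 / E * (b.1 - i.1),
   a.2 + min t D / D * (i.2 - a.2) + max (t - D) 0 / E * (b.2 - i.2))

theorem full_step {D : ℝ} {a i : ℝ × ℝ} (h : l1 (a - i) ≤ D) :
    D / D * (i.1 - a.1) = i.1 - a.1 ∧ D / D * (i.2 - a.2) = i.2 - a.2 := by
  simp only [l1, Prod.fst_sub, Prod.snd_sub] at h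
  by_cases hD : D = 0
  · subst hD
    have h1 := abs_nonneg (a.1 - i.1)
    have h2 := abs_nonneg (a.2 - i.2)
    have e1 : a.1 - i.1 = 0 := abs_eq_zero.mp (by linarith)
    have e2 : a.2 - i.2 = 0 := abs_eq_zero.mp (by linarith)
    constructor <;> simp <;> linarith
  · simp [div_self hD]

theorem step_bound {D x : ℝ} {a i : ℝ × ℝ} (h : l1 (a - i) ≤ D) :
    |x / D * (i.1 - a.1)| + |x / D * (i.2 - a.2)| ≤ |x| := by
  simp only [l1, Prod.fst_sub, Prod.snd_sub] at h
  have h1 := abs_nonneg (a.1 - i.1)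
  have h2 := abs_nonneg (a.2 - i.2)
  have hD : 0 ≤ D := by linarith
  rw [abs_mul, abs_mul, ← mul_add, abs_div, abs_of_nonneg hD, abs_sub_comm i.1, abs_sub_comm i.2]
  rcases hD.eq_or_lt with hD | hD
  · simp [← hD]
  · rw [div_mul_eq_mul_div, div_le_iff₀ hD]
    exact mul_le_mul_of_nonneg_left h (abs_nonneg x)

theorem clock_split (s t D : ℝ) :
    |min s D - min t D| + |max (s - D) 0 - max (t - D) 0| ≤ |s - t| := by
  grind

theorem pathVia_lip {D E : ℝ} {a i b : ℝ × ℝ} (h : l1 (a - i) ≤ D) (h' : l1 (i - b) ≤ E)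
    (T : ℝ) : Lip1On (pathVia D E a i b) T := by
  intro s _ t _
  have k1 := step_bound (x := min s D - min t D) h
  have k2 := step_bound (x := max (s - D) 0 - max (t - D) 0) h'
  have k3 := clock_split s t D
  have k4 := abs_add_le ((min s D - min t D) / D * (i.1 - a.1))
    ((max (s - D) 0 - max (t - D) 0) / E * (b.1 - i.1))
  have k5 := abs_add_le ((min s D - min t D) / D * (i.2 - a.2))
    ((max (s - D) 0 - max (t - D) 0) / E * (b.2 - i.2))
  have e1 : (pathVia D E a i b s - pathVia D E a i b t).1 =
    (min s D - min t D) / D * (i.1 - a.1) +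
    (max (s - D) 0 - max (t - D) 0) / E * (b.1 - i.1) := by
    simp only [pathVia, Prod.fst_sub]; ring
  have e2 : (pathVia D E a i b s - pathVia D E a i b t).2 =
    (min s D - min t D) / D * (i.2 - a.2) +
    (max (s - D) 0 - max (t - D) 0) / E * (b.2 - i.2) := by
    simp only [pathVia, Prod.snd_sub]; ring
  rw [l1, e1, e2]
  linarith

theorem pathVia_zero {D E : ℝ} (hD : 0 ≤ D) (a i b : ℝ × ℝ) : pathVia D E a i b 0 = a := by
  simp [pathVia, hD]

theorem pathVia_late {D E t : ℝ} {a i b : ℝ × ℝ} (h : l1 (a - i) ≤ D) (ht : D ≤ t) :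
    pathVia D E a i b t =
      (i.1 + (t - D) / E * (b.1 - i.1), i.2 + (t - D) / E * (b.2 - i.2)) := by
  obtain ⟨e1, e2⟩ := full_step h
  rw [pathVia, min_eq_right ht, max_eq_left (by linarith), e1, e2]
  ext <;> simp

theorem pathVia_mid {D E : ℝ} {a i b : ℝ × ℝ} (h : l1 (a - i) ≤ D) :
    pathVia D E a i b D = i := by
  rw [pathVia_late h le_rfl]; simp

theorem pathVia_end {D E : ℝ} {a i b : ℝ × ℝ} (h : l1 (a - i) ≤ D) (h' : l1 (i - b) ≤ E)
    (hE : 0 ≤ E) : pathVia D E a i b (D + E) = b := by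
  obtain ⟨e1, e2⟩ := full_step h'
  rw [pathVia_late h (by linarith), add_sub_cancel_left, e1, e2]
  ext <;> simp

theorem interp_gap {u p q r s : ℝ} (h0 : 0 ≤ u) (h1 : u ≤ 1) (hp : p ≥ q + 1) (hr : r ≥ s + 1) :
    1 ≤ (p + u * (r - p)) - (q + u * (s - q)) := by
  nlinarith [mul_nonneg h0 (sub_nonneg.2 hr), mul_nonneg (sub_nonneg.2 h1) (sub_nonneg.2 hp)]

theorem stmt12 (a₁ a₂ b₁ b₂ i₁ i₂ : ℝ × ℝ)
    (hA : Feasible2 a₁ a₂) (hB : Feasible2 b₁ b₂) (hI : Feasible2 i₁ i₂)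
    (hAup : a₁.2 ≥ a₂.2 + 1) (hBright : b₁.1 ≥ b₂.1 + 1)
    (hIx : i₁.1 ≥ i₂.1 + 1) (hIy : i₁.2 ≥ i₂.2 + 1)
    (T : ℝ)
    (hT : T = max (l1 (a₁ - i₁)) (l1 (a₂ - i₂)) + max (l1 (i₁ - b₁)) (l1 (i₂ - b₂))) :
    ∃ m₁ m₂ : ℝ → ℝ × ℝ, IsSchedule2 m₁ m₂ a₁ a₂ b₁ b₂ T ∧
      ∃ t ∈ Set.Icc (0:ℝ) T, m₁ t = i₁ ∧ m₂ t = i₂ := by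
  have n1 : ∀ p, 0 ≤ l1 p := fun p => add_nonneg (abs_nonneg _) (abs_nonneg _)
  obtain ⟨D, hD⟩ : ∃ D, D = max (l1 (a₁ - i₁)) (l1 (a₂ - i₂)) := ⟨_, rfl⟩
  obtain ⟨E, hE⟩ : ∃ E, E = max (l1 (i₁ - b₁)) (l1 (i₂ - b₂)) := ⟨_, rfl⟩
  rw [← hD, ← hE] at hT
  have d1 : l1 (a₁ - i₁) ≤ D := hD ▸ le_max_left _ _
  have d2 : l1 (a₂ - i₂) ≤ D := hD ▸ le_max_right _ _
  have c1 : l1 (i₁ - b₁) ≤ E := hE ▸ le_max_left _ _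
  have c2 : l1 (i₂ - b₂) ≤ E := hE ▸ le_max_right _ _
  have D0 : 0 ≤ D := (n1 _).trans d1
  have E0 : 0 ≤ E := (n1 _).trans c1
  subst hT
  refine ⟨pathVia D E a₁ i₁ b₁, pathVia D E a₂ i₂ b₂,
    ⟨by linarith, pathVia_zero D0 _ _ _, pathVia_zero D0 _ _ _, pathVia_end d1 c1 E0,
      pathVia_end d2 c2 E0, pathVia_lip d1 c1 _, pathVia_lip d2 c2 _, ?_⟩,
    D, ⟨D0, by linarith⟩, pathVia_mid d1, pathVia_mid d2⟩
  rintro t ⟨t0, tT⟩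
  rcases le_total t D with ht | ht
  · refine le_max_of_le_right (le_trans ?_ (le_abs_self _))
    simp only [pathVia, min_eq_left ht, max_eq_right (sub_nonpos.2 ht), zero_div, zero_mul,
      add_zero]
    exact interp_gap (div_nonneg t0 D0) (div_le_one_of_le₀ ht D0) hAup hIy
  · refine le_max_of_le_left (le_trans ?_ (le_abs_self _))
    rw [pathVia_late d1 ht, pathVia_late d2 ht]
    exact interp_gap (div_nonneg (by linarith) E0) (div_le_one_of_le₀ (by linarith) E0) hIx hBright
end

section
/- Let k ≥ 1 and let M be a feasible schedule over [0,T] from a feasible configuration A of k unit-square robots to a feasible configuration B, with every trajectory continuous. Then there exist T' ≤ T and a feasible schedule M' over [0,T'] from A to B such that each trajectory m'ᵢ is piecewise affine with at most 3 · 4^(k(k−1)/2) affine pieces: for every i there exist an integer N ≤ 3 · 4^(k(k−1)/2) and times 0 = s₀ ≤ s₁ ≤ … ≤ s_N = T' such that m'ᵢ restricted to each interval [s_j, s_{j+1}] is affine. In particular, each robot makes a number of turns bounded by a function of k only, independent of A, B and T. -/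
/-- One of the four coordinate functionals `±x`, `±y`. -/
noncomputable def sideFn (c : Bool × Bool) (d : ℝ × ℝ) : ℝ :=
  (if c.1 then 1 else -1) * (if c.2 then d.1 else d.2)

/-- The convex cell of configurations given by a choice of separating side for every pair. -/
def cell {k : ℕ} (σ : (Σ j : Fin k, Fin j.val) → Bool × Bool) : Set (Fin k → ℝ × ℝ) :=
  {P | ∀ p : (Σ j : Fin k, Fin j.val),
    1 ≤ sideFn (σ p) (P p.1 - P (Fin.castLE p.1.isLt.le p.2))}

lemma sideFn_comb (c : Bool × Bool) (a b : ℝ) (d e : ℝ × ℝ) :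
    sideFn c (a • d + b • e) = a * sideFn c d + b * sideFn c e := by
  unfold sideFn
  split_ifs <;> simp <;> ring

lemma sideFn_continuous (c : Bool × Bool) : Continuous (sideFn c) := by
  unfold sideFn
  split_ifs <;> fun_prop

lemma cell_closed {k : ℕ} (σ : (Σ j : Fin k, Fin j.val) → Bool × Bool) :
    IsClosed (cell σ) := by
  unfold cell
  rw [Set.ofPred_forall]
  refine isClosed_iInter fun p => ?_
  refine isClosed_le continuous_const ((sideFn_continuous _).comp ?_)
  fun_prop

lemma cell_convex {k : ℕ} (σ : (Σ j : Fin k, Fin j.val) → Bool × Bool) :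
    Convex ℝ (cell σ) := by
  intro P hP Q hQ a b ha hb hab p
  have h1 := hP p
  have h2 := hQ p
  have e : (a • P + b • Q) p.1 - (a • P + b • Q) (Fin.castLE p.1.isLt.le p.2)
      = a • (P p.1 - P (Fin.castLE p.1.isLt.le p.2))
        + b • (Q p.1 - Q (Fin.castLE p.1.isLt.le p.2)) := by
    simp only [Pi.add_apply, Pi.smul_apply, smul_sub]
    abel
  rw [e, sideFn_comb]
  nlinarith

lemma sideFn_le (c : Bool × Bool) (d : ℝ × ℝ) : sideFn c d ≤ max |d.1| |d.2| := by
  unfold sideFn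
  rw [le_max_iff]
  split_ifs
  · left; simpa using le_abs_self _
  · right; simpa using le_abs_self _
  · left; simpa using neg_le_abs _
  · right; simpa using neg_le_abs _

lemma exists_sideFn (d : ℝ × ℝ) (h : 1 ≤ max |d.1| |d.2|) : ∃ c, 1 ≤ sideFn c d := by
  rw [le_max_iff, le_abs, le_abs] at h
  rcases h with (h | h) | (h | h)
  · exact ⟨(true, true), by simpa [sideFn] using h⟩
  · exact ⟨(false, true), by simpa [sideFn] using h⟩
  · exact ⟨(true, false), by simpa [sideFn] using h⟩
  · exact ⟨(false, false), by simpa [sideFn] using h⟩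

lemma cell_feasible {k : ℕ} (σ : (Σ j : Fin k, Fin j.val) → Bool × Bool)
    {P : Fin k → ℝ × ℝ} (hP : P ∈ cell σ) : FeasibleConfig P := by
  have key : ∀ i j : Fin k, j < i → max |(P i).1 - (P j).1| |(P i).2 - (P j).2| ≥ 1 := by
    intro i j hij
    have h := hP ⟨i, ⟨j.val, hij⟩⟩
    exact h.trans (sideFn_le _ _)
  intro i j hij
  rcases lt_or_gt_of_ne hij with h | h
  · rw [abs_sub_comm (P i).1, abs_sub_comm (P i).2]
    exact key j i h
  · exact key i j h

lemma exists_cell {k : ℕ} {P : Fin k → ℝ × ℝ} (hP : FeasibleConfig P) :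
    ∃ σ, P ∈ cell σ := by
  have : ∀ p : (Σ j : Fin k, Fin j.val), ∃ c,
      1 ≤ sideFn c (P p.1 - P (Fin.castLE p.1.isLt.le p.2)) := by
    intro p
    apply exists_sideFn
    refine hP _ _ ?_
    intro h
    have h2 := congrArg Fin.val h
    have h3 := p.2.isLt
    simp at h2
    omega
  choose σ hσ using this
  exact ⟨σ, hσ⟩

lemma l1_add (p q : ℝ × ℝ) : l1 (p + q) ≤ l1 p + l1 q := by
  have h1 := abs_add_le p.1 q.1
  have h2 := abs_add_le p.2 q.2
  simp only [l1, Prod.fst_add, Prod.snd_add]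
  linarith

/-- `g` on `[a,b]` interpolates `f` at the ends, is Lipschitz, feasible,
and affine on `N` pieces. -/
def Good {k : ℕ} (f g : ℝ → Fin k → ℝ × ℝ) (a b : ℝ) (N : ℕ) : Prop :=
  g a = f a ∧ g b = f b ∧
  (∀ i, ∀ s ∈ Set.Icc a b, ∀ t ∈ Set.Icc a b, s ≤ t → l1 (g s i - g t i) ≤ t - s) ∧
  (∀ t ∈ Set.Icc a b, FeasibleConfig (g t)) ∧
  ∃ s : ℕ → ℝ, Monotone s ∧ s 0 = a ∧ s N = b ∧
    ∀ j < N, ∃ u v : Fin k → ℝ × ℝ, ∀ t ∈ Set.Icc (s j) (s (j + 1)), g t = u + t • v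

lemma good_line {k : ℕ} (f : ℝ → Fin k → ℝ × ℝ) (a b : ℝ) (hab : a ≤ b)
    (hl : ∀ i, l1 (f a i - f b i) ≤ b - a)
    (σ : (Σ j : Fin k, Fin j.val) → Bool × Bool) (ha : f a ∈ cell σ) (hb : f b ∈ cell σ) :
    ∃ g, Good f g a b 1 := by
  refine ⟨fun t => (f a - a • ((b - a)⁻¹ • (f b - f a))) + t • ((b - a)⁻¹ • (f b - f a)),
    ?_, ?_, ?_, ?_, ?_⟩
  · simp
  · rcases hab.eq_or_lt with rfl | h
    · simp
    · have : b - a ≠ 0 := by linarith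
      have e : f a - a • ((b - a)⁻¹ • (f b - f a)) + b • ((b - a)⁻¹ • (f b - f a))
          = f a + ((b - a) * (b - a)⁻¹) • (f b - f a) := by module
      simp only [e, mul_inv_cancel₀ this]
      simp
  · intro i s hs t ht hst
    have e : ((f a - a • ((b - a)⁻¹ • (f b - f a))) + s • ((b - a)⁻¹ • (f b - f a))) i
        - ((f a - a • ((b - a)⁻¹ • (f b - f a))) + t • ((b - a)⁻¹ • (f b - f a))) i
        = ((t - s) * (b - a)⁻¹) • (f a i - f b i) := by
      simp only [Pi.add_apply, Pi.sub_apply, Pi.smul_apply]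
      module
    simp only [e, l1_smul]
    have h0 : 0 ≤ (b - a)⁻¹ := inv_nonneg.2 (by linarith)
    rw [abs_of_nonneg (mul_nonneg (by linarith) h0), mul_assoc]
    have h1 : (b - a)⁻¹ * l1 (f a i - f b i) ≤ 1 :=
      (mul_le_mul_of_nonneg_left (hl i) h0).trans (inv_mul_le_one)
    nlinarith
  · intro t ht
    apply cell_feasible σ
    have h0 : 0 ≤ (b - a)⁻¹ := inv_nonneg.2 (by linarith)
    have h1 : 0 ≤ (t - a) * (b - a)⁻¹ := mul_nonneg (by linarith [ht.1]) h0
    have h2 : (t - a) * (b - a)⁻¹ ≤ 1 := by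
      rw [← div_eq_mul_inv]
      exact div_le_one_of_le₀ (by linarith [ht.2]) (by linarith)
    have := cell_convex σ ha hb (a := 1 - (t - a) * (b - a)⁻¹) (b := (t - a) * (b - a)⁻¹)
      (by linarith) h1 (by ring)
    convert this using 1
    module
  · refine ⟨fun n => if n = 0 then a else b, ?_, by simp, by simp, ?_⟩
    · refine monotone_nat_of_le_succ fun n => ?_
      simp only [Nat.add_eq_zero_iff, one_ne_zero, and_false, if_false]
      split_ifs
      · exact hab
      · exact le_rfl
    · intro j _
      exact ⟨_, _, fun t _ => rfl⟩

lemma good_concat {k : ℕ} (f g h : ℝ → Fin k → ℝ × ℝ) (a b c : ℝ) (N : ℕ)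
    (hab : a ≤ b) (hbc : b ≤ c) (hg : Good f g a b 1) (hh : Good f h b c N) :
    ∃ e, Good f e a c (N + 1) := by
  obtain ⟨g1, g2, g3, g4, s, s1, s2, s3, s4⟩ := hg
  obtain ⟨h1, h2, h3, h4, r, r1, r2, r3, r4⟩ := hh
  have eg : ∀ t, t ≤ b → (if t ≤ b then g t else h t) = g t := fun t ht => if_pos ht
  have eh : ∀ t, b ≤ t → (if t ≤ b then g t else h t) = h t := by
    intro t ht
    split_ifs with h5
    · have : t = b := le_antisymm h5 ht
      rw [this, g2, h1]
    · rfl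
  refine ⟨fun t => if t ≤ b then g t else h t, ?_, ?_, ?_, ?_, ?_⟩
  · exact (eg a hab).trans g1
  · exact (eh c hbc).trans h2
  · intro i x hx y hy hxy
    rcases le_total y b with hyb | hyb
    · simp only [eg y hyb, eg x (hxy.trans hyb)]
      exact g3 i x ⟨hx.1, hxy.trans hyb⟩ y ⟨hy.1, hyb⟩ hxy
    · rcases le_total x b with hxb | hxb
      · simp only [eg x hxb, eh y hyb]
        have e1 := g3 i x ⟨hx.1, hxb⟩ b ⟨hab, le_rfl⟩ hxb
        have e2 := h3 i b ⟨le_rfl, hbc⟩ y ⟨hyb, hy.2⟩ hyb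
        have e3 := l1_add (g x i - g b i) (h b i - h y i)
        have e4 : g x i - g b i + (h b i - h y i) = g x i - h y i := by
          rw [g2, h1]; abel
        rw [e4] at e3
        linarith
      · simp only [eh y hyb, eh x hxb]
        exact h3 i x ⟨hxb, hx.2⟩ y ⟨hyb, hy.2⟩ hxy
  · intro t ht
    rcases le_total t b with h5 | h5
    · simp only [eg t h5]; exact g4 t ⟨ht.1, h5⟩
    · simp only [eh t h5]; exact h4 t ⟨h5, ht.2⟩
  · refine ⟨fun n => Nat.casesOn n a r, ?_, rfl, r3, ?_⟩
    · refine monotone_nat_of_le_succ fun n => ?_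
      cases n with
      | zero => simpa [r2] using hab
      | succ n => exact r1 (Nat.le_succ n)
    · intro j hj
      cases j with
      | zero =>
        obtain ⟨u, v, huv⟩ := s4 0 (by norm_num)
        refine ⟨u, v, fun t ht => ?_⟩
        have ht' : t ∈ Set.Icc a b := by simpa [r2] using ht
        simp only [eg t ht'.2]
        exact huv t (by rw [s2, zero_add, s3]; exact ht')
      | succ j =>
        obtain ⟨u, v, huv⟩ := r4 j (by omega)
        refine ⟨u, v, fun t ht => ?_⟩
        have ht' : t ∈ Set.Icc (r j) (r (j + 1)) := ht
        have hb : b ≤ t := by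
          rw [← r2]; exact (r1 (Nat.zero_le j)).trans ht'.1
        simp only [eh t hb]
        exact huv t ht'

lemma exists_good {k : ℕ} (f : ℝ → Fin k → ℝ × ℝ) (T : ℝ) (n : ℕ) :
    ∀ (S : Finset ((Σ j : Fin k, Fin j.val) → Bool × Bool)) (a : ℝ), S.card = n → a ≤ T →
      ContinuousOn f (Set.Icc a T) →
      (∀ i, ∀ s ∈ Set.Icc a T, ∀ t ∈ Set.Icc a T, s ≤ t → l1 (f s i - f t i) ≤ t - s) →
      (∀ t ∈ Set.Icc a T, ∃ σ ∈ S, f t ∈ cell σ) →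
      ∃ N ≤ n, ∃ g, Good f g a T N := by
  induction n with
  | zero =>
    intro S a hS haT _ _ hf
    obtain ⟨σ, hσ, _⟩ := hf a ⟨le_rfl, haT⟩
    rw [Finset.card_eq_zero.1 hS] at hσ
    simp at hσ
  | succ n ih =>
    intro S a hS haT hcont hlip hf
    obtain ⟨σ, hσ, hfa⟩ := hf a ⟨le_rfl, haT⟩
    have hK : IsCompact (Set.Icc a T ∩ f ⁻¹' cell σ) :=
      isCompact_Icc.of_isClosed_subset
        (hcont.preimage_isClosed_of_isClosed isClosed_Icc (cell_closed σ)) Set.inter_subset_left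
    obtain ⟨b, ⟨hb, hfb⟩, hmax⟩ := hK.exists_isGreatest ⟨a, ⟨le_rfl, haT⟩, hfa⟩
    obtain ⟨g, hg⟩ := good_line f a b hb.1
      (fun i => hlip i a ⟨le_rfl, haT⟩ b hb hb.1) σ hfa hfb
    rcases hb.2.eq_or_lt with rfl | hbT
    · exact ⟨1, by omega, g, hg⟩
    have hsub : Set.Icc b T ⊆ Set.Icc a T := Set.Icc_subset_Icc_left hb.1
    have hclosed : IsClosed (⋃ τ ∈ S.erase σ, cell τ) :=
      isClosed_biUnion_finset fun τ _ => cell_closed τ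
    have hcl : IsClosed (Set.Icc b T ∩ f ⁻¹' (⋃ τ ∈ S.erase σ, cell τ)) :=
      (hcont.mono hsub).preimage_isClosed_of_isClosed isClosed_Icc hclosed
    have hIoc : Set.Ioc b T ⊆ Set.Icc b T ∩ f ⁻¹' (⋃ τ ∈ S.erase σ, cell τ) := by
      intro t ht
      have ht' : t ∈ Set.Icc b T := ⟨ht.1.le, ht.2⟩
      refine ⟨ht', ?_⟩
      obtain ⟨τ, hτ, hft⟩ := hf t (hsub ht')
      simp only [Set.mem_preimage, Set.mem_iUnion]
      refine ⟨τ, Finset.mem_erase.2 ⟨?_, hτ⟩, hft⟩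
      rintro rfl
      exact absurd (hmax ⟨hsub ht', hft⟩) (not_le.2 ht.1)
    have hIcc := closure_minimal hIoc hcl
    rw [closure_Ioc hbT.ne] at hIcc
    obtain ⟨N, hN, h, hh⟩ := ih (S.erase σ) b (by rw [Finset.card_erase_of_mem hσ, hS]; rfl)
      hb.2 (hcont.mono hsub) (fun i s hs t ht => hlip i s (hsub hs) t (hsub ht)) (by
        intro t ht
        have := (hIcc ht).2
        simp only [Set.mem_preimage, Set.mem_iUnion] at this
        obtain ⟨τ, h1, h2⟩ := this
        exact ⟨τ, h1, h2⟩)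
    exact ⟨N + 1, by omega, good_concat f g h a b T N hb.1 hb.2 hg hh⟩

theorem stmt15 (k : ℕ) (hk : 1 ≤ k) (A B : Fin k → ℝ × ℝ) (T : ℝ)
    (m : Fin k → ℝ → ℝ × ℝ) (hsch : IsScheduleK m A B T)
    (hc : ∀ i, ContinuousOn (m i) (Set.Icc 0 T)) :
    ∃ T' ≤ T, ∃ m' : Fin k → ℝ → ℝ × ℝ,
      IsScheduleK m' A B T' ∧
      ∀ i, ∃ N : ℕ, N ≤ 3 * 4 ^ (k * (k - 1) / 2) ∧
        ∃ s : Fin (N + 1) → ℝ, Monotone s ∧ s 0 = 0 ∧ s (Fin.last N) = T' ∧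
          ∀ j : Fin N, ∃ u v : ℝ × ℝ,
            ∀ t ∈ Set.Icc (s j.castSucc) (s j.succ), m' i t = u + t • v := by
  obtain ⟨hT, h0, h1, hlip, hfeas⟩ := hsch
  have hcard : (Finset.univ : Finset ((Σ j : Fin k, Fin j.val) → Bool × Bool)).card
      = 4 ^ (k * (k - 1) / 2) := by
    rw [Finset.card_univ, Fintype.card_fun, Fintype.card_sigma]
    simp only [Fintype.card_fin, Fintype.card_prod, Fintype.card_bool]
    rw [Fin.sum_univ_eq_sum_range (fun i => i) k, Finset.sum_range_id]
  obtain ⟨N, hN, g, g1, g2, g3, g4, s, s1, s2, s3, s4⟩ :=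
    exists_good (fun t i => m i t) T _ Finset.univ 0 hcard hT (continuousOn_pi.2 hc)
      (by
        intro i s hs t ht hst
        have := hlip i s hs t ht
        rwa [abs_sub_comm, abs_of_nonneg (by linarith)] at this)
      (by
        intro t ht
        obtain ⟨σ, hσ⟩ := exists_cell (hfeas t ht)
        exact ⟨σ, Finset.mem_univ _, hσ⟩)
  refine ⟨T, le_rfl, fun i t => g t i, ⟨hT, ?_, ?_, ?_, g4⟩, ?_⟩
  · intro i
    simp only [g1, h0]
  · intro i
    simp only [g2, h1]
  · intro i x hx y hy
    rcases le_total x y with h | h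
    · rw [abs_sub_comm, abs_of_nonneg (by linarith)]
      exact g3 i x hx y hy h
    · rw [abs_of_nonneg (by linarith), l1_sub_comm]
      exact g3 i y hy x hx h
  · intro i
    refine ⟨N, by omega, fun j => s j.val, fun x y hxy => s1 hxy, s2, s3, ?_⟩
    intro j
    obtain ⟨u, v, huv⟩ := s4 j.val j.isLt
    exact ⟨u i, v i, fun t ht => by simp only [huv t ht]; rfl⟩
end
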